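/- Let T be the Bel–Robinson tensor of a 4-dimensional vacuum spacetime, T_{abcd} = C_{aecf}C_b{}^e{}_d{}^f + *C_{aecf}*C_b{}^e{}_d{}^f where C is the Weyl tensor and *C its left dual. Then T is totally symmetric and trace-free in any pair of indices, and for any future-directed timelike vectors u, v, w, z one has T(u,v,w,z) ≥ 0. -/

import Mathlib

open Finset

/-- Minkowski metric `diag(−1,1,1,1)` on `ℝ⁴` (index form; it is its own inverse). -/
def eta : Fin 4 → Fin 4 → ℝ := fun i j =>
  if i = j then (if i = 0 then -1 else 1) else 0

/-- Sign of an integer, as a real number. -/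
def isgn (z : ℤ) : ℝ := if 0 < z then 1 else if z < 0 then -1 else 0

/-- The Levi-Civita symbol on four indices (lower indices, `ε_{0123} = +1`). -/
def eps (a b c d : Fin 4) : ℝ :=
  isgn ((b : ℤ) - a) * isgn ((c : ℤ) - a) * isgn ((d : ℤ) - a) *
    isgn ((c : ℤ) - b) * isgn ((d : ℤ) - b) * isgn ((d : ℤ) - c)

/-- The left dual `*C_{abcd} = (1/2) ε_{ab}{}^{ef} C_{efcd}` of a 4-tensor,
indices raised with the Minkowski metric. -/
noncomputable def leftDual (C : Fin 4 → Fin 4 → Fin 4 → Fin 4 → ℝ) :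
    Fin 4 → Fin 4 → Fin 4 → Fin 4 → ℝ := fun a b c d =>
  (1 / 2) * ∑ e, ∑ f, ∑ e', ∑ f',
    eps a b e f * eta e e' * eta f f' * C e' f' c d

/-- The Bel–Robinson tensor
`T_{abcd} = C_{aecf} C_b{}^e{}_d{}^f + *C_{aecf} *C_b{}^e{}_d{}^f`. -/
noncomputable def belRobinson (C : Fin 4 → Fin 4 → Fin 4 → Fin 4 → ℝ) :
    Fin 4 → Fin 4 → Fin 4 → Fin 4 → ℝ := fun a b c d =>
  ∑ e, ∑ f, ∑ e', ∑ f', eta e e' * eta f f' *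
    (C a e c f * C b e' d f' + leftDual C a e c f * leftDual C b e' d f')

/-- A (pointwise) Weyl-type tensor on 4-dimensional Minkowski space: all the
algebraic symmetries of the Weyl tensor. -/
structure IsWeylTensor (C : Fin 4 → Fin 4 → Fin 4 → Fin 4 → ℝ) : Prop where
  antisym₁ : ∀ a b c d, C b a c d = -C a b c d
  antisym₂ : ∀ a b c d, C a b d c = -C a b c d
  pairsym : ∀ a b c d, C c d a b = C a b c d
  bianchi : ∀ a b c d, C a b c d + C a c d b + C a d b c = 0
  traceFree : ∀ c d, ∑ a, ∑ b, eta a b * C a c b d = 0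

/-- A vector is future-directed timelike if `η(u,u) < 0` and `u⁰ > 0`. -/
def FutureTimelike (u : Fin 4 → ℝ) : Prop :=
  (∑ a, ∑ b, eta a b * u a * u b) < 0 ∧ 0 < u 0


/-- Signs of the bivector basis `01, 02, 03, 23, 31, 12`. -/
def bvSign : Fin 4 → Fin 4 → ℝ :=
  ![![0, 1, 1, 1], ![-1, 0, 1, -1], ![-1, -1, 0, 1], ![-1, 1, -1, 0]]

/-- Position of a pair of indices in the bivector basis. -/
def bvIdx : Fin 4 → Fin 4 → Fin 6 :=
  ![![0, 0, 1, 2], ![0, 0, 5, 4], ![1, 5, 0, 3], ![2, 4, 3, 0]]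

/-- The `6 × 6` matrix of a Weyl tensor with electric part `p` and magnetic part `q`. -/
def bvMat (p q : Fin 5 → ℝ) : Fin 6 → Fin 6 → ℝ :=
  ![![p 0, p 1, p 2, q 0, q 1, q 2],
    ![p 1, p 3, p 4, q 1, q 3, q 4],
    ![p 2, p 4, -p 0 - p 3, q 2, q 4, -q 0 - q 3],
    ![q 0, q 1, q 2, -p 0, -p 1, -p 2],
    ![q 1, q 3, q 4, -p 1, -p 3, -p 4],
    ![q 2, q 4, -q 0 - q 3, -p 2, -p 4, p 0 + p 3]]

/-- The Weyl tensor with electric part `p` and magnetic part `q`. -/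
def weylOf (p q : Fin 5 → ℝ) (a b c d : Fin 4) : ℝ :=
  bvSign a b * bvSign c d * bvMat p q (bvIdx a b) (bvIdx c d)

/-- First and second index of a bivector basis element. -/
def bvL : Fin 6 → Fin 4 := ![0, 0, 0, 2, 3, 1]

def bvR : Fin 6 → Fin 4 := ![1, 2, 3, 3, 1, 2]

lemma antisym_repr (f : Fin 4 → Fin 4 → ℝ) (hf : ∀ a b, f b a = - f a b) (a b : Fin 4) :
    f a b = bvSign a b * f (bvL (bvIdx a b)) (bvR (bvIdx a b)) := by
  have h00 := hf a a
  have h := hf a b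
  fin_cases a <;> fin_cases b <;> simp [bvSign, bvIdx, bvL, bvR] at h h00 ⊢ <;> linarith

lemma weyl_repr (C : Fin 4 → Fin 4 → Fin 4 → Fin 4 → ℝ) (hC : IsWeylTensor C) :
    C = weylOf ![C 0 1 0 1, C 0 1 0 2, C 0 1 0 3, C 0 2 0 2, C 0 2 0 3]
      ![C 0 1 2 3, C 0 1 3 1, C 0 1 1 2, C 0 2 3 1, C 0 2 1 2] := by
  have key : ∀ I J : Fin 6, C (bvL I) (bvR I) (bvL J) (bvR J) =
      bvMat ![C 0 1 0 1, C 0 1 0 2, C 0 1 0 3, C 0 2 0 2, C 0 2 0 3]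
      ![C 0 1 2 3, C 0 1 3 1, C 0 1 1 2, C 0 2 3 1, C 0 2 1 2] I J := by
    have tr : ∀ c d, - C 0 c 0 d + C 1 c 1 d + C 2 c 2 d + C 3 c 3 d = 0 := by
      intro c d
      have := hC.traceFree c d
      simpa [Fin.sum_univ_four, eta] using this
    have z1 : ∀ a c d, C a a c d = 0 := fun a c d => by
      have := hC.antisym₁ a a c d; linarith
    have z2 : ∀ a c d, C c d a a = 0 := fun a c d => by
      have := hC.antisym₂ c d a a; linarith
    have ps := hC.pairsym
    have a1 := hC.antisym₁
    have a2 := hC.antisym₂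
    have bi := hC.bianchi 0 1 2 3
    -- normal forms
    have n10 := a1 0 1
    have n20 := a1 0 2
    have n30 := a1 0 3
    have n21 := a1 1 2
    have n13 := a1 3 1
    have n32 := a1 2 3
    have m10 := fun a b => a2 a b 0 1
    have m20 := fun a b => a2 a b 0 2
    have m30 := fun a b => a2 a b 0 3
    have m21 := fun a b => a2 a b 1 2
    have m13 := fun a b => a2 a b 3 1
    have m32 := fun a b => a2 a b 2 3
    have p1 := ps 0 1 0 2
    have p2 := ps 0 1 0 3
    have p3 := ps 0 2 0 3
    have p4 := ps 2 3 3 1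
    have p5 := ps 2 3 1 2
    have p6 := ps 3 1 1 2
    have q1 := ps 0 1 2 3
    have q2 := ps 0 1 3 1
    have q3 := ps 0 1 1 2
    have q4 := ps 0 2 2 3
    have q5 := ps 0 2 3 1
    have q6 := ps 0 2 1 2
    have q7 := ps 0 3 2 3
    have q8 := ps 0 3 3 1
    have q9 := ps 0 3 1 2
    have t00 := tr 0 0
    have t01 := tr 0 1
    have t02 := tr 0 2
    have t03 := tr 0 3
    have t11 := tr 1 1
    have t12 := tr 1 2
    have t13 := tr 1 3
    have t22 := tr 2 2
    have t23 := tr 2 3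
    have t33 := tr 3 3
    simp only [z1, z2, n10, n20, n30, n21, n13, n32, m10, m20, m30, m21, m13, m32] at bi t00 t01 t02 t03 t11 t12 t13 t22 t23 t33
    intro I J
    fin_cases I <;> fin_cases J <;> simp [bvL, bvR, bvMat] <;> linarith
  funext a b c d
  rw [antisym_repr (fun x y => C x y c d) (fun x y => hC.antisym₁ x y c d) a b]
  rw [antisym_repr (fun x y => C _ _ x y) (fun x y => hC.antisym₂ _ _ x y) c d]
  rw [key, weylOf]
  ring

lemma leftDual_weylOf (p q : Fin 5 → ℝ) :
    leftDual (weylOf p q) = weylOf q (fun i => - p i) := by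
  have h : ∀ C : Fin 4 → Fin 4 → Fin 4 → Fin 4 → ℝ, ∀ a b c d, leftDual C a b c d =
      (1 / 2) * ∑ e, ∑ f, eps a b e f * eta e e * eta f f * C e f c d := by
    intro C a b c d
    simp [leftDual, eta]
  have h2 : ∀ (a b : Fin 4) (X : Fin 6 → ℝ), (1 / 2) * ∑ e, ∑ f, eps a b e f * eta e e * eta f f *
      (bvSign e f * X (bvIdx e f)) =
      bvSign a b * ![X 3, X 4, X 5, -X 0, -X 1, -X 2] (bvIdx a b) := by
    intro a b X
    fin_cases a <;> fin_cases b <;>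
      simp [Fin.sum_univ_four, eps, isgn, eta, bvSign, bvIdx] <;> ring
  funext a b c d
  rw [h]
  have := h2 a b (fun I => bvSign c d * bvMat p q I (bvIdx c d))
  rw [show (∑ e, ∑ f, eps a b e f * eta e e * eta f f * weylOf p q e f c d) =
    ∑ e, ∑ f, eps a b e f * eta e e * eta f f *
      (bvSign e f * (bvSign c d * bvMat p q (bvIdx e f) (bvIdx c d))) by
    simp only [weylOf, mul_assoc], this, weylOf, mul_assoc]
  congr 1
  generalize bvIdx a b = I
  generalize bvIdx c d = J
  fin_cases I <;> fin_cases J <;> simp [bvMat] <;> ring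

lemma belRobinson_eq (C : Fin 4 → Fin 4 → Fin 4 → Fin 4 → ℝ) (a b c d : Fin 4) :
    belRobinson C a b c d = ∑ e, ∑ f, eta e e * eta f f *
      (C a e c f * C b e d f + leftDual C a e c f * leftDual C b e d f) := by
  simp only [belRobinson]
  refine Finset.sum_congr rfl fun e _ => Finset.sum_congr rfl fun f _ => ?_
  rw [Finset.sum_eq_single e _ (by simp), Finset.sum_eq_single f _ (by simp)]
  · intro f' _ h
    simp [eta, h.symm]
  · intro e' _ h
    simp [eta, h.symm]

/-- The five components of the Weyl spinor. -/
noncomputable def psiN (p q : Fin 5 → ℝ) : ℕ → ℂ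
  | 0 => ⟨p 0 - p 3 + 2 * q 1, -q 0 + q 3 + 2 * p 1⟩
  | 1 => ⟨-p 2 - q 4, q 2 - p 4⟩
  | 2 => ⟨-p 0 - p 3, q 0 + q 3⟩
  | 3 => ⟨p 2 - q 4, -q 2 - p 4⟩
  | _ => ⟨p 0 - p 3 - 2 * q 1, -q 0 + q 3 - 2 * p 1⟩

/-- The Weyl spinor. -/
noncomputable def psi (p q : Fin 5 → ℝ) (A B C D : Fin 2) : ℂ :=
  psiN p q (A.val + B.val + C.val + D.val)

/-- Phases of the Pauli matrices. -/
noncomputable def phase : Fin 4 → Fin 2 → ℂ :=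
  ![![1, 1], ![1, 1], ![-Complex.I, Complex.I], ![1, -1]]

/-- Flips of the Pauli matrices. -/
def flip2 : Fin 4 → Fin 2 → Fin 2 := ![![0, 1], ![1, 0], ![1, 0], ![0, 1]]

/-- Components of the self-dual bivector basis. -/
noncomputable def sdVec : Fin 3 → Fin 6 → ℂ :=
  ![![1, 0, 0, Complex.I, 0, 0], ![0, 1, 0, 0, Complex.I, 0], ![0, 0, 1, 0, 0, Complex.I]]

/-- The self-dual bivector basis. -/
noncomputable def sdM (i : Fin 3) (a e : Fin 4) : ℂ := bvSign a e * sdVec i (bvIdx a e)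

/-- The complex symmetric trace-free matrix `E - i B`. -/
noncomputable def qMat (p q : Fin 5 → ℝ) : Fin 3 → Fin 3 → ℂ :=
  ![![⟨p 0, -q 0⟩, ⟨p 1, -q 1⟩, ⟨p 2, -q 2⟩],
    ![⟨p 1, -q 1⟩, ⟨p 3, -q 3⟩, ⟨p 4, -q 4⟩],
    ![⟨p 2, -q 2⟩, ⟨p 4, -q 4⟩, ⟨-p 0 - p 3, q 0 + q 3⟩]]

/-- Spinor components of the self-dual bivectors. -/
noncomputable def sdSpin : Fin 3 → Fin 2 → Fin 2 → ℂ :=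
  ![![![1, 0], ![0, -1]], ![![Complex.I, 0], ![0, Complex.I]], ![![0, -1], ![-1, 0]]]

/-- The complex self-dual Weyl tensor. -/
noncomputable def sdWeyl (p q : Fin 5 → ℝ) (a e c f : Fin 4) : ℂ :=
  ∑ i, ∑ j, qMat p q i j * sdM i a e * sdM j c f

lemma sdWeyl_eq (p q : Fin 5 → ℝ) (a e c f : Fin 4) :
    sdWeyl p q a e c f = ⟨weylOf p q a e c f, - weylOf q (fun i => - p i) a e c f⟩ := by
  have h : ∀ I J : Fin 6, ∑ i, ∑ j, qMat p q i j * sdVec i I * sdVec j J =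
      ⟨bvMat p q I J, - bvMat q (fun i => - p i) I J⟩ := by
    intro I J
    apply Complex.ext <;> fin_cases I <;> fin_cases J <;>
      simp [Fin.sum_univ_three, qMat, sdVec, bvMat] <;> ring
  have h2 : sdWeyl p q a e c f = ((bvSign a e * bvSign c f : ℝ) : ℂ) *
      ∑ i, ∑ j, qMat p q i j * sdVec i (bvIdx a e) * sdVec j (bvIdx c f) := by
    simp only [sdWeyl, sdM, Finset.mul_sum]
    refine Finset.sum_congr rfl fun i _ => Finset.sum_congr rfl fun j _ => ?_
    push_cast
    ring
  rw [h2, h]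
  apply Complex.ext
  · rw [Complex.re_ofReal_mul]; simp only [weylOf]
  · rw [Complex.im_ofReal_mul]; simp only [weylOf]; ring

lemma psi_eq (p q : Fin 5 → ℝ) (A B C D : Fin 2) :
    psi p q A B C D = ∑ i, ∑ j, qMat p q i j * sdSpin i A B * sdSpin j C D := by
  apply Complex.ext <;> fin_cases A <;> fin_cases B <;> fin_cases C <;> fin_cases D <;>
    simp [Fin.sum_univ_three, qMat, sdSpin, psi, psiN] <;> ring

set_option maxHeartbeats 1000000 in
lemma sdM_contract (i k : Fin 3) (a b : Fin 4) :
    ∑ e, (eta e e : ℂ) * (sdM i a e * star (sdM k b e)) =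
      ∑ x : Fin 2 × Fin 2, (phase a x.1 * phase b x.2 / 2) *
        (sdSpin i x.1 x.2 * star (sdSpin k (flip2 a x.1) (flip2 b x.2))) := by
  rw [Fintype.sum_prod_type]
  fin_cases i <;> fin_cases k <;> fin_cases a <;> fin_cases b <;>
    simp [Fin.sum_univ_four, eta, sdM, bvSign, bvIdx, sdVec, phase, sdSpin, flip2] <;>
    norm_num [Complex.ext_iff]

lemma bilin_swap {ι κ : Type} [Fintype ι] [Fintype κ] (Q R : κ → κ → ℂ) (w w' : ι → ℂ)
    (m m' n n' : κ → ι → ℂ) :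
    ∑ e, ∑ f, w e * w' f * ((∑ i, ∑ j, Q i j * m i e * n j f) *
      (∑ k, ∑ l, R k l * m' k e * n' l f)) =
    ∑ i, ∑ j, ∑ k, ∑ l, Q i j * R k l * ((∑ e, w e * (m i e * m' k e)) *
      (∑ f, w' f * (n j f * n' l f))) := by
  have h1 : ∀ e f, w e * w' f * ((∑ i, ∑ j, Q i j * m i e * n j f) *
      (∑ k, ∑ l, R k l * m' k e * n' l f)) =
      ∑ y : (κ × κ) × (κ × κ), Q y.1.1 y.1.2 * R y.2.1 y.2.2 *
        ((w e * (m y.1.1 e * m' y.2.1 e)) * (w' f * (n y.1.2 f * n' y.2.2 f))) := by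
    intro e f
    rw [← Fintype.sum_prod_type' (f := fun i j => Q i j * m i e * n j f),
      ← Fintype.sum_prod_type' (f := fun k l => R k l * m' k e * n' l f),
      Finset.sum_mul_sum, ← Fintype.sum_prod_type' (f := fun (x y : κ × κ) =>
        Q x.1 x.2 * m x.1 e * n x.2 f * (R y.1 y.2 * m' y.1 e * n' y.2 f)), Finset.mul_sum]
    refine Finset.sum_congr rfl fun y _ => ?_
    ring
  have h2 : ∀ i j k l, Q i j * R k l * ((∑ e, w e * (m i e * m' k e)) *
      (∑ f, w' f * (n j f * n' l f))) = ∑ x : ι × ι, Q i j * R k l *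
        ((w x.1 * (m i x.1 * m' k x.1)) * (w' x.2 * (n j x.2 * n' l x.2))) := by
    intro i j k l
    rw [Finset.sum_mul_sum, ← Fintype.sum_prod_type', Finset.mul_sum]
  simp only [h1, h2]
  rw [← Fintype.sum_prod_type', Finset.sum_comm, Fintype.sum_prod_type, Fintype.sum_prod_type]
  refine Finset.sum_congr rfl fun i _ => Finset.sum_congr rfl fun j _ => ?_
  rw [Fintype.sum_prod_type]

/-- Contraction of a spinor index pair with a Pauli matrix. -/
noncomputable def lam (a : Fin 4) (G : Fin 2 → Fin 2 → ℂ) : ℂ :=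
  ∑ A, phase a A * G A (flip2 a A)

/-- The spinor form of the Bel-Robinson tensor. -/
noncomputable def spinT (p q : Fin 5 → ℝ) (a b c d : Fin 4) : ℂ :=
  lam a fun A A' => lam b fun B B' => lam c fun C C' => lam d fun D D' =>
    psi p q A B C D * star (psi p q A' B' C' D')

lemma belRobinson_weylOf (p q : Fin 5 → ℝ) (a b c d : Fin 4) :
    belRobinson (weylOf p q) a b c d = (1 / 4) * (spinT p q a b c d).re := by
  have h1 : belRobinson (weylOf p q) a b c d = (∑ e, ∑ f, (eta e e : ℂ) * (eta f f : ℂ) *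
      (sdWeyl p q a e c f * star (sdWeyl p q b e d f))).re := by
    rw [belRobinson_eq, leftDual_weylOf, Complex.re_sum]
    refine Finset.sum_congr rfl fun e _ => ?_
    rw [Complex.re_sum]
    refine Finset.sum_congr rfl fun f _ => ?_
    rw [← Complex.ofReal_mul, Complex.re_ofReal_mul, sdWeyl_eq, sdWeyl_eq]
    simp
  have h2 : ∀ a e c f, star (sdWeyl p q a e c f) =
      ∑ i, ∑ j, star (qMat p q i j) * star (sdM i a e) * star (sdM j c f) := by
    intro a e c f
    simp only [sdWeyl, star_sum, star_mul']
  have h3 : ∀ A B C D, star (psi p q A B C D) =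
      ∑ i, ∑ j, star (qMat p q i j) * star (sdSpin i A B) * star (sdSpin j C D) := by
    intro A B C D
    simp only [psi_eq, star_sum, star_mul']
  have h4 : (∑ e, ∑ f, (eta e e : ℂ) * (eta f f : ℂ) *
      (sdWeyl p q a e c f * star (sdWeyl p q b e d f))) =
      ∑ x : Fin 2 × Fin 2, ∑ y : Fin 2 × Fin 2,
        (phase a x.1 * phase b x.2 / 2) * (phase c y.1 * phase d y.2 / 2) *
        (psi p q x.1 x.2 y.1 y.2 * star (psi p q (flip2 a x.1) (flip2 b x.2)
          (flip2 c y.1) (flip2 d y.2))) := by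
    simp only [h2, h3]
    simp only [sdWeyl, psi_eq]
    rw [bilin_swap (qMat p q) (fun i j => star (qMat p q i j)) (fun e => (eta e e : ℂ))
      (fun e => (eta e e : ℂ)) (fun i e => sdM i a e) (fun i e => star (sdM i b e))
      (fun i e => sdM i c e) (fun i e => star (sdM i d e))]
    rw [bilin_swap (qMat p q) (fun i j => star (qMat p q i j))
      (fun x : Fin 2 × Fin 2 => phase a x.1 * phase b x.2 / 2)
      (fun x : Fin 2 × Fin 2 => phase c x.1 * phase d x.2 / 2)
      (fun i x => sdSpin i x.1 x.2) (fun i x => star (sdSpin i (flip2 a x.1) (flip2 b x.2)))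
      (fun i x => sdSpin i x.1 x.2) (fun i x => star (sdSpin i (flip2 c x.1) (flip2 d x.2)))]
    simp only [sdM_contract]
  rw [h1, h4, ← Complex.re_ofReal_mul]
  congr 1
  simp only [spinT, lam, Fintype.sum_prod_type, Finset.mul_sum]
  refine Finset.sum_congr rfl fun A _ => Finset.sum_congr rfl fun B _ =>
    Finset.sum_congr rfl fun C _ => Finset.sum_congr rfl fun D _ => ?_
  push_cast
  ring

lemma lam_comm (a b : Fin 4) (G : Fin 2 → Fin 2 → Fin 2 → Fin 2 → ℂ) :
    (lam a fun A A' => lam b fun B B' => G A A' B B') =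
      lam b fun B B' => lam a fun A A' => G A A' B B' := by
  simp only [lam, Fin.sum_univ_two]
  ring

lemma spinT_swap01 (p q : Fin 5 → ℝ) (a b c d : Fin 4) :
    spinT p q b a c d = spinT p q a b c d := by
  unfold spinT
  rw [lam_comm]
  have h : ∀ A B C D, psi p q B A C D = psi p q A B C D := by
    intro A B C D; unfold psi; congr 1; omega
  simp only [h]

lemma spinT_swap12 (p q : Fin 5 → ℝ) (a b c d : Fin 4) :
    spinT p q a c b d = spinT p q a b c d := by
  unfold spinT
  have h : ∀ A B C D, psi p q A C B D = psi p q A B C D := by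
    intro A B C D; unfold psi; congr 1; omega
  congr 1
  funext A A'
  rw [lam_comm]
  simp only [h]

lemma spinT_swap23 (p q : Fin 5 → ℝ) (a b c d : Fin 4) :
    spinT p q a b d c = spinT p q a b c d := by
  unfold spinT
  have h : ∀ A B C D, psi p q A B D C = psi p q A B C D := by
    intro A B C D; unfold psi; congr 1; omega
  congr 1
  funext A A'
  congr 1
  funext B B'
  rw [lam_comm]
  simp only [h]

lemma lam_trace (G : Fin 2 → Fin 2 → Fin 2 → Fin 2 → ℂ)
    (h : ∀ A' B', G 0 A' 1 B' = G 1 A' 0 B') :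
    ∑ a, (eta a a : ℂ) * (lam a fun A A' => lam a fun B B' => G A A' B B') = 0 := by
  simp [Fin.sum_univ_four, lam, Fin.sum_univ_two, eta, phase, flip2, h]
  linear_combination (G 0 1 0 1 + G 1 0 1 0 - G 1 1 0 0 - G 1 0 0 1) * Complex.I_sq

lemma spinT_trace (p q : Fin 5 → ℝ) (c d : Fin 4) :
    ∑ a, (eta a a : ℂ) * spinT p q a a c d = 0 := by
  unfold spinT
  exact lam_trace (fun A A' B B' => lam c fun C C' => lam d fun D D' =>
    psi p q A B C D * star (psi p q A' B' C' D')) (fun A' B' => by simp [psi])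

lemma lam_sum {ι : Type} [Fintype ι] (a : Fin 4) (v : ι → ℂ) (G : ι → Fin 2 → Fin 2 → ℂ) :
    ∑ b, v b * lam a (G b) = lam a fun A A' => ∑ b, v b * G b A A' := by
  simp only [lam, Fin.sum_univ_two, mul_add, Finset.sum_add_distrib, Finset.mul_sum]
  congr 1 <;> refine Finset.sum_congr rfl fun b _ => ?_ <;> ring

lemma futureTimelike_decomp (u : Fin 4 → ℝ) (hu : FutureTimelike u) :
    ∃ m : Fin 2 → Fin 2 → ℂ, ∀ G : Fin 2 → Fin 2 → ℂ,
      ∑ a, (u a : ℂ) * lam a G = ∑ j, ∑ A, ∑ A', m j A * star (m j A') * G A A' := by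
  obtain ⟨h1, h0⟩ := hu
  simp [Fin.sum_univ_four, eta] at h1
  have hs : 0 < u 0 + u 3 := by nlinarith [sq_nonneg (u 1), sq_nonneg (u 2)]
  have ht : 0 ≤ u 0 - u 3 - (u 1 ^ 2 + u 2 ^ 2) / (u 0 + u 3) := by
    rw [sub_nonneg, div_le_iff₀ hs]
    nlinarith
  obtain ⟨r, hr, hr2⟩ : ∃ r : ℝ, 0 < r ∧ r * r = u 0 + u 3 :=
    ⟨√(u 0 + u 3), Real.sqrt_pos.2 hs, Real.mul_self_sqrt hs.le⟩
  obtain ⟨t, ht2⟩ : ∃ t : ℝ, t * t = u 0 - u 3 - (u 1 ^ 2 + u 2 ^ 2) / (u 0 + u 3) :=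
    ⟨√_, Real.mul_self_sqrt ht⟩
  have hrne : r ≠ 0 := hr.ne'
  refine ⟨![![(r : ℂ), ⟨u 1 / r, u 2 / r⟩], ![0, (t : ℂ)]], fun G => ?_⟩
  have e00 : (r : ℂ) * star (r : ℂ) = u 0 + u 3 := by
    apply Complex.ext <;> simp [hr2]
  have e01 : (r : ℂ) * star (⟨u 1 / r, u 2 / r⟩ : ℂ) = u 1 - u 2 * Complex.I := by
    apply Complex.ext <;> simp <;> field_simp
  have e10 : (⟨u 1 / r, u 2 / r⟩ : ℂ) * star (r : ℂ) = u 1 + u 2 * Complex.I := by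
    apply Complex.ext <;> simp <;> field_simp
  have e11 : (⟨u 1 / r, u 2 / r⟩ : ℂ) * star (⟨u 1 / r, u 2 / r⟩ : ℂ) + t * star (t : ℂ) =
      u 0 - u 3 := by
    apply Complex.ext
    · simp [ht2, ← hr2]
      field_simp
      ring
    · simp
      ring
  have key : ∑ a, (u a : ℂ) * lam a G = (u 0 + u 3) * G 0 0 + (u 1 - u 2 * Complex.I) * G 0 1 +
      (u 1 + u 2 * Complex.I) * G 1 0 + (u 0 - u 3) * G 1 1 := by
    simp [Fin.sum_univ_four, lam, Fin.sum_univ_two, phase, flip2]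
    ring
  rw [key, ← e00, ← e01, ← e10, ← e11]
  simp [Fin.sum_univ_two]
  ring

/-- A kernel which is a sum of squares. -/
def IsSOS {γ : Type} (K : γ → γ → ℂ) : Prop :=
  ∃ n : ℕ, ∃ f : Fin n → γ → ℂ, ∀ x y, K x y = ∑ i, f i x * star (f i y)

lemma IsSOS.contract {γ : Type} {K : Fin 2 → Fin 2 → γ → γ → ℂ}
    (hK : IsSOS (fun x y : Fin 2 × γ => K x.1 y.1 x.2 y.2))
    (u : Fin 4 → ℝ) (hu : FutureTimelike u) :
    IsSOS (fun x y : γ => ∑ a, (u a : ℂ) * lam a fun A A' => K A A' x y) := by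
  obtain ⟨m, hm⟩ := futureTimelike_decomp u hu
  obtain ⟨n, f, hf⟩ := hK
  refine ⟨n * 2, fun k x => ∑ A, m (finProdFinEquiv.symm k).2 A *
    f (finProdFinEquiv.symm k).1 (A, x), fun x y => ?_⟩
  beta_reduce
  rw [hm]
  rw [Equiv.sum_comp finProdFinEquiv.symm (fun k : Fin n × Fin 2 =>
    (∑ A, m k.2 A * f k.1 (A, x)) * star (∑ A, m k.2 A * f k.1 (A, y)))]
  rw [Fintype.sum_prod_type_right]
  have hK' : ∀ A A', K A A' x y = ∑ i, f i (A, x) * star (f i (A', y)) :=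
    fun A A' => hf (A, x) (A', y)
  apply Finset.sum_congr rfl
  intro j _
  simp only [hK', Fin.sum_univ_two, star_add, star_mul']
  simp only [Finset.mul_sum, ← Finset.sum_add_distrib]
  apply Finset.sum_congr rfl
  intro i _
  ring

lemma spinT_nonneg (p q : Fin 5 → ℝ) (u v w z : Fin 4 → ℝ) (hu : FutureTimelike u)
    (hv : FutureTimelike v) (hw : FutureTimelike w) (hz : FutureTimelike z) :
    0 ≤ (∑ a, (u a : ℂ) * ∑ b, (v b : ℂ) * ∑ c, (w c : ℂ) * ∑ d, (z d : ℂ) *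
      spinT p q a b c d).re := by
  have k0 : IsSOS (fun x y : Fin 2 × (Fin 2 × (Fin 2 × (Fin 2 × Unit))) =>
      psi p q x.2.2.2.1 x.2.2.1 x.2.1 x.1 * star (psi p q y.2.2.2.1 y.2.2.1 y.2.1 y.1)) :=
    ⟨1, fun _ x => psi p q x.2.2.2.1 x.2.2.1 x.2.1 x.1, fun x y => by simp⟩
  have k1 := IsSOS.contract (K := fun D D' (x y : Fin 2 × (Fin 2 × (Fin 2 × Unit))) => psi p q x.2.2.1 x.2.1 x.1 D *
    star (psi p q y.2.2.1 y.2.1 y.1 D')) k0 z hz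
  have k2 := IsSOS.contract (K := fun C C' (x y : Fin 2 × (Fin 2 × Unit)) => ∑ d, (z d : ℂ) * lam d fun D D' =>
    psi p q x.2.1 x.1 C D * star (psi p q y.2.1 y.1 C' D')) k1 w hw
  have k3 := IsSOS.contract (K := fun B B' (x y : Fin 2 × Unit) => ∑ c, (w c : ℂ) * lam c fun C C' =>
    ∑ d, (z d : ℂ) * lam d fun D D' =>
    psi p q x.1 B C D * star (psi p q y.1 B' C' D')) k2 v hv
  have k4 := IsSOS.contract (K := fun A A' (x y : Unit) => ∑ b, (v b : ℂ) * lam b fun B B' =>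
    ∑ c, (w c : ℂ) * lam c fun C C' => ∑ d, (z d : ℂ) * lam d fun D D' =>
    psi p q A B C D * star (psi p q A' B' C' D')) k3 u hu
  obtain ⟨n, f, hf⟩ := k4
  have h := hf () ()
  dsimp only at h
  simp only [spinT, lam_sum]
  rw [h, Complex.re_sum]
  refine Finset.sum_nonneg fun i _ => ?_
  simp
  nlinarith [sq_nonneg (f i ()).re, sq_nonneg (f i ()).im]

/-- The Bel–Robinson tensor of a Weyl-type tensor on 4-dimensional Minkowski
space is totally symmetric, trace-free in any pair of indices, and
nonnegative on future-directed timelike vectors (dominant property). -/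
theorem belRobinson_symmetric_traceFree_positive
    (C : Fin 4 → Fin 4 → Fin 4 → Fin 4 → ℝ) (hC : IsWeylTensor C) :
    (∀ σ : Equiv.Perm (Fin 4), ∀ v : Fin 4 → Fin 4,
      belRobinson C (v (σ 0)) (v (σ 1)) (v (σ 2)) (v (σ 3)) =
        belRobinson C (v 0) (v 1) (v 2) (v 3)) ∧
    (∀ c d, ∑ a, ∑ b, eta a b * belRobinson C a b c d = 0) ∧
    (∀ u v w z : Fin 4 → ℝ, FutureTimelike u → FutureTimelike v →
      FutureTimelike w → FutureTimelike z →
      0 ≤ ∑ a, ∑ b, ∑ c, ∑ d,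
        belRobinson C a b c d * u a * v b * w c * z d) := by
  rw [weyl_repr C hC]
  generalize ![C 0 1 0 1, C 0 1 0 2, C 0 1 0 3, C 0 2 0 2, C 0 2 0 3] = p
  generalize ![C 0 1 2 3, C 0 1 3 1, C 0 1 1 2, C 0 2 3 1, C 0 2 1 2] = q
  refine ⟨?_, ?_, ?_⟩
  · intro σ v
    simp only [belRobinson_weylOf]
    congr 2
    have h01 : σ 0 ≠ σ 1 := fun h => by simpa using σ.injective h
    have h02 : σ 0 ≠ σ 2 := fun h => by simpa using σ.injective h
    have h03 : σ 0 ≠ σ 3 := fun h => by simpa using σ.injective h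
    have h12 : σ 1 ≠ σ 2 := fun h => by simpa using σ.injective h
    have h13 : σ 1 ≠ σ 3 := fun h => by simpa using σ.injective h
    have h23 : σ 2 ≠ σ 3 := fun h => by simpa using σ.injective h
    have gen : ∀ i j k l : Fin 4, i ≠ j → i ≠ k → i ≠ l → j ≠ k → j ≠ l → k ≠ l →
        spinT p q (v i) (v j) (v k) (v l) = spinT p q (v 0) (v 1) (v 2) (v 3) := by
      generalize e0 : v 0 = x0
      generalize e1 : v 1 = x1
      generalize e2 : v 2 = x2
      generalize e3 : v 3 = x3
      intro i j k l
      fin_cases i <;> fin_cases j <;> try simp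
      all_goals fin_cases k <;> try simp
      all_goals fin_cases l <;> simp [e0, e1, e2, e3]
      all_goals simp only [spinT_swap01, spinT_swap12, spinT_swap23]
    exact gen _ _ _ _ h01 h02 h03 h12 h13 h23
  · intro c d
    have h : ∀ a, ∑ b, eta a b * belRobinson (weylOf p q) a b c d =
        eta a a * belRobinson (weylOf p q) a a c d := by
      intro a
      rw [Finset.sum_eq_single a _ (by simp)]
      intro b _ hb
      simp [eta, hb.symm]
    rw [Finset.sum_congr rfl fun a _ => h a]
    simp only [belRobinson_weylOf]
    have h2 := congrArg Complex.re (spinT_trace p q c d)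
    simp only [Complex.re_sum, Complex.re_ofReal_mul, Complex.zero_re] at h2
    rw [← mul_zero (1 / 4 : ℝ), ← h2, Finset.mul_sum]
    refine Finset.sum_congr rfl fun a _ => ?_
    ring
  · intro u v w z hu hv hw hz
    have h := spinT_nonneg p q u v w z hu hv hw hz
    have e : (∑ a, ∑ b, ∑ c, ∑ d, belRobinson (weylOf p q) a b c d * u a * v b * w c * z d) =
        (1 / 4) * (∑ a, (u a : ℂ) * ∑ b, (v b : ℂ) * ∑ c, (w c : ℂ) * ∑ d, (z d : ℂ) *
          spinT p q a b c d).re := by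
      simp only [Complex.re_sum, Complex.re_ofReal_mul, Finset.mul_sum, belRobinson_weylOf]
      refine Finset.sum_congr rfl fun a _ => Finset.sum_congr rfl fun b _ =>
        Finset.sum_congr rfl fun c _ => Finset.sum_congr rfl fun d _ => ?_
      ring
    rw [e]
    positivity
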